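/- Suppose |𝒴| = k > 2. Let s = (𝐱_s, 𝐱_t, 𝐲_s) be an (m,n)-sample with positive probability under π, let q be a probability mass function on 𝒳, and let g be any classifier. Then the posterior-expected target-domain risk of g satisfies Σ_{f'} ρ(f'|s) · R(g|q, f') ≥ (U(s, q) − 1)/log₂(k − 1). -/

import Mathlib

open Finset
open scoped Classical BigOperators

noncomputable section

/-- A UDA class over input space `X` and label space `Y`: a finitely supported
probability distribution `π` over triples `(p, q, f)`, where `p` and `q` are
probability mass functions on `X` and `f : X → Y` is a classifier. -/
structure UDAClass (X Y : Type*) [Fintype X] where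
  supp : Finset ((X → ℝ) × (X → ℝ) × (X → Y))
  w : ((X → ℝ) × (X → ℝ) × (X → Y)) → ℝ
  w_nonneg : ∀ t, 0 ≤ w t
  w_eq_zero : ∀ t ∉ supp, w t = 0
  w_sum : ∑ t ∈ supp, w t = 1
  p_nonneg : ∀ t ∈ supp, ∀ x, 0 ≤ t.1 x
  p_sum : ∀ t ∈ supp, ∑ x, t.1 x = 1
  q_nonneg : ∀ t ∈ supp, ∀ x, 0 ≤ t.2.1 x
  q_sum : ∀ t ∈ supp, ∑ x, t.2.1 x = 1

variable {X Y : Type*} [Fintype X] [Fintype Y] [DecidableEq X] [DecidableEq Y]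

/-- An `(m,n)`-sample `s = (x_s, x_t, y_s)`. -/
abbrev Sample (X Y : Type*) (m n : ℕ) := (Fin m → X) × (Fin n → X) × (Fin m → Y)

/-- The i.i.d. probability `p^m(xs) = ∏ i, p (xs i)` of a vector. -/
def iidProb {m : ℕ} (p : X → ℝ) (xs : Fin m → X) : ℝ := ∏ i, p (xs i)

/-- The normalizing constant `Z(s)`. -/
def Zval (π : UDAClass X Y) {m n : ℕ} (s : Sample X Y m n) : ℝ :=
  ∑ t ∈ π.supp, π.w t * iidProb t.1 s.1 * iidProb t.2.1 s.2.1 *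
    (if ∀ i, t.2.2 (s.1 i) = s.2.2 i then 1 else 0)

/-- The posterior over classifiers `ρ(f' | s)`. -/
def post (π : UDAClass X Y) {m n : ℕ} (s : Sample X Y m n) (f' : X → Y) : ℝ :=
  (∑ t ∈ π.supp, π.w t * iidProb t.1 s.1 * iidProb t.2.1 s.2.1 *
      (if t.2.2 = f' then 1 else 0) * (if ∀ i, f' (s.1 i) = s.2.2 i then 1 else 0))
    / Zval π s

/-- The aggregated soft classifier `ρ^A(y | x, s)`. -/
def postA (π : UDAClass X Y) {m n : ℕ} (s : Sample X Y m n) (x : X) (y : Y) : ℝ :=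
  ∑ f' : X → Y, post π s f' * (if f' x = y then 1 else 0)

/-- The target-domain risk `R(g | q, f)`. -/
def risk (g : X → Y) (q : X → ℝ) (f : X → Y) : ℝ :=
  ∑ x, q x * (if g x ≠ f x then 1 else 0)

/-- A learner assigns a probability distribution over classifiers to each sample. -/
def IsLearner {m n : ℕ} (A : Sample X Y m n → (X → Y) → ℝ) : Prop :=
  ∀ s, (∀ g, 0 ≤ A s g) ∧ ∑ g : X → Y, A s g = 1

/-- The sample-wise risk `e(𝒜; s, q)`. -/
def swRisk (π : UDAClass X Y) {m n : ℕ} (A : Sample X Y m n → (X → Y) → ℝ)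
    (s : Sample X Y m n) (q : X → ℝ) : ℝ :=
  ∑ x, q x * ∑ f' : X → Y, ∑ g : X → Y,
    post π s f' * A s g * (if f' x ≠ g x then 1 else 0)

/-- The optimal sample-wise risk `e*(s, q)`: the minimum of `e(𝒜; s, q)` over learners. -/
def eStar (π : UDAClass X Y) {m n : ℕ} (s : Sample X Y m n) (q : X → ℝ) : ℝ :=
  sInf {r : ℝ | ∃ A : Sample X Y m n → (X → Y) → ℝ, IsLearner A ∧ swRisk π A s q = r}

/-- Base-2 Shannon entropy of a distribution on a finite set. -/
def entropy2 {Z : Type*} [Fintype Z] (μ : Z → ℝ) : ℝ :=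
  -∑ z, μ z * Real.logb 2 (μ z)

/-- The Posterior Target Label Uncertainty `U(s, q)`. -/
def PTLU (π : UDAClass X Y) {m n : ℕ} (s : Sample X Y m n) (q : X → ℝ) : ℝ :=
  ∑ x, q x * entropy2 (fun y => postA π s x y)

/-- The Empirical Posterior Target Label Uncertainty `Ũ(s)`. -/
def EPTLU (π : UDAClass X Y) {m n : ℕ} (s : Sample X Y m n) : ℝ :=
  (1 / (n : ℝ)) * ∑ i : Fin n, entropy2 (fun y => postA π s (s.2.1 i) y)

/-- The conditional distribution `π_{F|P,Q}(f' | p, q)`. -/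
def condF (π : UDAClass X Y) (p q : X → ℝ) (f' : X → Y) : ℝ :=
  π.w (p, q, f') / ∑ f'' : X → Y, π.w (p, q, f'')

/-- The posterior over classifiers given the infinite-sample observation `(p, q, f_p)`. -/
def postInf (π : UDAClass X Y) (p q : X → ℝ) (f f' : X → Y) : ℝ :=
  (condF π p q f' * (if ∀ x, p x ≠ 0 → f' x = f x then 1 else 0)) /
    ∑ f'' : X → Y, condF π p q f'' * (if ∀ x, p x ≠ 0 → f'' x = f x then 1 else 0)

/-- Aggregation `ρ^A(y | x, p, q, f_p)` of the infinite-sample posterior. -/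
def postAInf (π : UDAClass X Y) (p q : X → ℝ) (f : X → Y) (x : X) (y : Y) : ℝ :=
  ∑ f' : X → Y, postInf π p q f f' * (if f' x = y then 1 else 0)

/-- The restriction `f_p` of a classifier `f` to the support of `p`. -/
def restrictSupp (p : X → ℝ) (f : X → Y) : {x : X // p x ≠ 0} → Y := fun x => f x.1

/-- An infinite-sample learner: maps each observation `(p, q, f_p)` to a
distribution over classifiers. -/
abbrev InfLearner (X Y : Type*) :=
  (p : X → ℝ) → (X → ℝ) → ({x : X // p x ≠ 0} → Y) → ((X → Y) → ℝ)

def IsInfLearner (A : InfLearner X Y) : Prop :=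
  ∀ p q fp, (∀ g, 0 ≤ A p q fp g) ∧ ∑ g : X → Y, A p q fp g = 1

/-- The sample-wise risk `e(𝒜_∞; p, q, f_p)` of an infinite-sample learner. -/
def swRiskInf (π : UDAClass X Y) (A : InfLearner X Y) (p q : X → ℝ) (f : X → Y) : ℝ :=
  ∑ x, q x * ∑ f' : X → Y, ∑ g : X → Y,
    postInf π p q f f' * A p q (restrictSupp p f) g * (if f' x ≠ g x then 1 else 0)

/-- The optimal sample-wise risk `e*(p, q, f_p)` on an infinite-sample observation. -/
def eStarInf (π : UDAClass X Y) (p q : X → ℝ) (f : X → Y) : ℝ :=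
  sInf {r : ℝ | ∃ A : InfLearner X Y, IsInfLearner A ∧ swRiskInf π A p q f = r}

/-- The PTLU `U(p, q, f_p)` on an infinite-sample observation. -/
def PTLUInf (π : UDAClass X Y) (p q : X → ℝ) (f : X → Y) : ℝ :=
  ∑ x, q x * entropy2 (fun y => postAInf π p q f x y)

/-- The expected target-domain risk `R(𝒜 | p, q, f)`. -/
def expRisk {m n : ℕ} (A : Sample X Y m n → (X → Y) → ℝ) (p q : X → ℝ) (f : X → Y) : ℝ :=
  ∑ xs : Fin m → X, ∑ xt : Fin n → X,
    iidProb p xs * iidProb q xt * ∑ g : X → Y, A (xs, xt, fun i => f (xs i)) g * risk g q f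

/-- The overall target-domain risk `R(𝒜)`. -/
def overallRisk (π : UDAClass X Y) {m n : ℕ} (A : Sample X Y m n → (X → Y) → ℝ) : ℝ :=
  ∑ t ∈ π.supp, π.w t * expRisk A t.1 t.2.1 t.2.2

/-- The overall target-domain risk `R(𝒜_∞)` of an infinite-sample learner. -/
def overallRiskInf (π : UDAClass X Y) (A : InfLearner X Y) : ℝ :=
  ∑ t ∈ π.supp, π.w t *
    ∑ g : X → Y, A t.1 t.2.1 (restrictSupp t.1 t.2.2) g * risk g t.2.1 t.2.2

/-- The Gibbs inequality: cross-entropy dominates entropy. -/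
lemma entropy2_le_cross_entropy {Z : Type*} [Fintype Z] (μ r : Z → ℝ)
    (hμ : ∀ z, 0 ≤ μ z) (hr : ∀ z, 0 < r z) (hsum : ∑ z, r z = ∑ z, μ z) :
    entropy2 μ ≤ -∑ z, μ z * Real.logb 2 (r z) := by
  have hterm : ∀ z, μ z * Real.log (r z) - μ z * Real.log (μ z) ≤ r z - μ z := by
    intro z
    rcases (hμ z).eq_or_lt with h | h
    · simpa [← h] using (hr z).le
    · have hl := Real.log_le_sub_one_of_pos (div_pos (hr z) h)
      rw [Real.log_div (hr z).ne' h.ne'] at hl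
      have hm := mul_le_mul_of_nonneg_left hl h.le
      rw [mul_sub, mul_sub, mul_div_cancel₀ _ h.ne'] at hm
      linarith
  have hle : ∑ z, μ z * Real.log (r z) ≤ ∑ z, μ z * Real.log (μ z) := by
    have h := Finset.sum_le_sum fun z (_ : z ∈ Finset.univ) => hterm z
    rw [Finset.sum_sub_distrib, Finset.sum_sub_distrib, hsum] at h
    linarith
  simp only [entropy2, Real.logb, ← mul_div_assoc, ← Finset.sum_div]
  exact neg_le_neg (div_le_div_of_nonneg_right hle (Real.log_nonneg (by norm_num)))

/-- The Fano inequality for a single guess `z₀`, with the binary entropy bounded by `1`. -/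
lemma entropy2_le_fano {Z : Type*} [Fintype Z] (hk : 1 < Fintype.card Z) (μ : Z → ℝ)
    (hμ : ∀ z, 0 ≤ μ z) (hsum : ∑ z, μ z = 1) (z₀ : Z) :
    entropy2 μ ≤ 1 + (1 - μ z₀) * Real.logb 2 ((Fintype.card Z : ℝ) - 1) := by
  have hc : (0 : ℝ) < (Fintype.card Z : ℝ) - 1 := by
    have : (1 : ℝ) < Fintype.card Z := by exact_mod_cast hk
    linarith
  have hsplit : ∀ φ : Z → ℝ, ∑ z, φ z = φ z₀ + ∑ z ∈ Finset.univ.erase z₀, φ z :=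
    fun φ => (Finset.add_sum_erase _ φ (Finset.mem_univ z₀)).symm
  set r : Z → ℝ := fun z => if z = z₀ then 2⁻¹ else (2 * ((Fintype.card Z : ℝ) - 1))⁻¹ with hr
  have hr₀ : r z₀ = 2⁻¹ := by simp [hr]
  have hr₁ : ∀ z ∈ Finset.univ.erase z₀, r z = (2 * ((Fintype.card Z : ℝ) - 1))⁻¹ :=
    fun z hz => by simp [hr, Finset.ne_of_mem_erase hz]
  have hrpos : ∀ z, 0 < r z := fun z => by
    simp only [hr]
    split_ifs <;> positivity
  have hrsum : ∑ z, r z = 1 := by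
    rw [hsplit, hr₀, Finset.sum_congr rfl hr₁, Finset.sum_const,
      Finset.card_erase_of_mem (Finset.mem_univ _), Finset.card_univ, nsmul_eq_mul,
      Nat.cast_sub hk.le, Nat.cast_one]
    field_simp
    norm_num
  refine (entropy2_le_cross_entropy μ r hμ hrpos (hrsum.trans hsum.symm)).trans_eq ?_
  have hμ₁ : ∑ z ∈ Finset.univ.erase z₀, μ z = 1 - μ z₀ := by
    rw [← hsum, hsplit μ]
    ring
  have h2 : Real.logb 2 (2 : ℝ) = 1 := Real.logb_self_eq_one (by norm_num)
  rw [hsplit, hr₀, Finset.sum_congr rfl fun z hz => by rw [hr₁ z hz], ← Finset.sum_mul, hμ₁,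
    Real.logb_inv, Real.logb_inv, Real.logb_mul two_ne_zero hc.ne', h2]
  ring

lemma iidProb_nonneg {X : Type*} {m : ℕ} {p : X → ℝ} (hp : ∀ x, 0 ≤ p x) (xs : Fin m → X) :
    0 ≤ iidProb p xs :=
  Finset.prod_nonneg fun _ _ => hp _

section Posterior

variable {X Y : Type*} [Fintype X] [DecidableEq Y] (π : UDAClass X Y) {m n : ℕ}
  (s : Sample X Y m n)

lemma post_nonneg (hZ : 0 < Zval π s) (f : X → Y) : 0 ≤ post π s f := by
  refine div_nonneg (Finset.sum_nonneg fun t ht => ?_) hZ.le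
  have h₁ := iidProb_nonneg (π.p_nonneg t ht) s.1
  have h₂ := iidProb_nonneg (π.q_nonneg t ht) s.2.1
  have h₃ := π.w_nonneg t
  positivity

variable [Fintype Y] [DecidableEq X]

lemma sum_post (hZ : 0 < Zval π s) : ∑ f : X → Y, post π s f = 1 := by
  simp only [post]
  rw [← Finset.sum_div, div_eq_one_iff_eq hZ.ne', Finset.sum_comm, Zval]
  refine Finset.sum_congr rfl fun t _ => ?_
  rw [Finset.sum_eq_single t.2.2]
  · simp
  · intro f _ hf
    simp [hf.symm]
  · simp

lemma postA_nonneg (hZ : 0 < Zval π s) (x : X) (y : Y) : 0 ≤ postA π s x y :=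
  Finset.sum_nonneg fun f _ => mul_nonneg (post_nonneg π s hZ f) (by positivity)

lemma sum_postA (hZ : 0 < Zval π s) (x : X) : ∑ y, postA π s x y = 1 := by
  simp only [postA]
  rw [Finset.sum_comm]
  simpa using sum_post π s hZ

lemma sum_post_mul_risk (hZ : 0 < Zval π s) (q : X → ℝ) (g : X → Y) :
    ∑ f : X → Y, post π s f * risk g q f = ∑ x, q x * (1 - postA π s x (g x)) := by
  simp only [risk, Finset.mul_sum]
  rw [Finset.sum_comm]
  refine Finset.sum_congr rfl fun x _ => ?_
  have hsub : 1 - postA π s x (g x) =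
      ∑ f : X → Y, (post π s f - post π s f * (if f x = g x then 1 else 0)) := by
    rw [Finset.sum_sub_distrib, sum_post π s hZ, postA]
  rw [hsub, Finset.mul_sum]
  refine Finset.sum_congr rfl fun f _ => ?_
  by_cases h : f x = g x
  · simp [h]
  · simp [h, Ne.symm h, mul_comm]

end Posterior

/-- for any classifier `g`, the posterior-expected target-domain
risk satisfies `Σ_{f'} ρ(f'|s) R(g|q,f') ≥ (U(s,q) − 1)/log₂(k−1)` when `k > 2`. -/
theorem posterior_expected_risk_ge_of_two_lt_card
    {X Y : Type*} [Fintype X] [Nonempty X] [Fintype Y] [DecidableEq X] [DecidableEq Y]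
    (hk : 2 < Fintype.card Y)
    (π : UDAClass X Y) {m n : ℕ} (s : Sample X Y m n) (hZ : 0 < Zval π s)
    (q : X → ℝ) (hq0 : ∀ x, 0 ≤ q x) (hq1 : ∑ x, q x = 1)
    (g : X → Y) :
    (PTLU π s q - 1) / Real.logb 2 ((Fintype.card Y : ℝ) - 1) ≤
      ∑ f' : X → Y, post π s f' * risk g q f' := by
  have hk' : (2 : ℝ) < Fintype.card Y := by exact_mod_cast hk
  have hlog : 0 < Real.logb 2 ((Fintype.card Y : ℝ) - 1) :=
    Real.logb_pos (by norm_num) (by linarith)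
  rw [div_le_iff₀ hlog, sum_post_mul_risk π s hZ q g, sub_le_iff_le_add, PTLU, Finset.sum_mul]
  nth_rewrite 3 [← hq1]
  rw [← Finset.sum_add_distrib]
  refine Finset.sum_le_sum fun x _ => ?_
  have h := entropy2_le_fano (by omega) (fun y => postA π s x y)
    (postA_nonneg π s hZ x) (sum_postA π s hZ x) (g x)
  calc q x * entropy2 (fun y => postA π s x y)
      ≤ q x * (1 + (1 - postA π s x (g x)) * Real.logb 2 ((Fintype.card Y : ℝ) - 1)) :=
        mul_le_mul_of_nonneg_left h (hq0 x)
    _ = _ := by ring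

end
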